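/- Deadlock-freedom of the synthesized locking scheme (abstract form of the paper's Theorem 3.2(b)): let ⤳ be a binary relation on a type P of predicates, with ⇌ defined as mutual ⤳*-reachability, and let lm : P → L be a lock-allocation map such that lm φ₁ = lm φ₂ whenever φ₁ ⇌ φ₂. Let T be a type of threads and hold : T → L → Prop a lock-holding relation. Suppose k ≥ 2 and there exist t : Fin k → T and p, q : Fin k → P such that for every index i (with index addition modulo k): q i ⇌ p i, p i ⤳ q (i+1), thread t i holds lock lm (p i), and thread t i does not hold lock lm (q (i+1)) (it is waiting to acquire it). Then a contradiction follows (False); i.e., no such deadlock cycle exists. -/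

import Mathlib

open Relation

/-- Mutual reachability under the reflexive-transitive closure of `r`. -/
def MutReach {P : Type*} (r : P → P → Prop) (p q : P) : Prop :=
  Relation.ReflTransGen r p q ∧ Relation.ReflTransGen r q p

/-- Deadlock-freedom of the synthesized locking scheme: if the lock-allocation map `lm`
is constant on `⇌`-equivalence classes, then no deadlock cycle (each thread `t i`
holding `lm (p i)` and waiting for `lm (q (i+1))`, with `q i ⇌ p i` and
`p i ⤳ q (i+1)`) can exist. -/
theorem deadlock_freedom {P L T : Type*} (r : P → P → Prop)
    (lm : P → L)
    (hlm : ∀ φ₁ φ₂ : P, MutReach r φ₁ φ₂ → lm φ₁ = lm φ₂)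
    (hold : T → L → Prop)
    (k : ℕ) (hk : 2 ≤ k) (t : Fin k → T) (p q : Fin k → P)
    (h : ∀ i : Fin k,
      MutReach r (q i) (p i) ∧
      r (p i) (q ⟨((i : ℕ) + 1) % k, Nat.mod_lt _ (by omega)⟩) ∧
      hold (t i) (lm (p i)) ∧
      ¬ hold (t i) (lm (q ⟨((i : ℕ) + 1) % k, Nat.mod_lt _ (by omega)⟩))) :
    False := by
  have hpos : 0 < k := by omega
  have reach : ∀ n : ℕ, ReflTransGen r (q ⟨1 % k, Nat.mod_lt _ hpos⟩)
      (q ⟨(1 + n) % k, Nat.mod_lt _ hpos⟩) := by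
    intro n
    induction n with
    | zero => exact .refl
    | succ n ih =>
      obtain ⟨hqp, hstep, -⟩ := h ⟨(1 + n) % k, Nat.mod_lt _ hpos⟩
      simp only [Nat.mod_add_mod] at hstep
      exact (ih.trans hqp.1).tail hstep
  have hback := reach (k - 1)
  simp only [Nat.add_sub_cancel' hpos, Nat.mod_self] at hback
  obtain ⟨hqp, hstep, hheld, hwait⟩ := h ⟨0, hpos⟩
  simp only [Nat.zero_add] at hstep hwait
  exact hwait (hlm _ _ ⟨.single hstep, hback.trans hqp.1⟩ ▸ hheld)
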